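/- arXiv:2006.00893 — 2 statements merged into one kernel-verified Lean document; each statement's English description precedes it below -/
import Mathlib

section
/- Let 𝓑 be an unbounded bornology on an infinite set I such that the family {I \ B : B ∈ 𝓑} is an ultrafilter on I. Then the 𝓑-macrocube is not normal. -/
open scoped symmDiff

/-- A bornology on a set (type) `ι`: a family of subsets containing all finite
subsets, closed under taking subsets and finite unions. -/
def IsBornology {ι : Type*} (𝓑 : Set (Set ι)) : Prop :=
  (∀ A : Set ι, A.Finite → A ∈ 𝓑) ∧
  (∀ A B : Set ι, A ∈ 𝓑 → B ⊆ A → B ∈ 𝓑) ∧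
  (∀ A B : Set ι, A ∈ 𝓑 → B ∈ 𝓑 → A ∪ B ∈ 𝓑)

/-- `E_B[Y]` in the `𝓑`-macrocube: the points of the macrocube (members of `𝓑`)
that are `B`-close to some member of `Y`. -/
def mcE {ι : Type*} (𝓑 : Set (Set ι)) (B : Set ι) (Y : Set (Set ι)) : Set (Set ι) :=
  {A | A ∈ 𝓑 ∧ ∃ A' ∈ Y, A ∆ A' ⊆ B}

/-- A subset of the `𝓑`-macrocube is bounded if all pairwise symmetric
differences are contained in a single member of `𝓑`. -/
def mcBounded {ι : Type*} (𝓑 : Set (Set ι)) (Y : Set (Set ι)) : Prop :=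
  ∃ B ∈ 𝓑, ∀ A ∈ Y, ∀ A' ∈ Y, A ∆ A' ⊆ B

/-- Asymptotic disjointness in the `𝓑`-macrocube. -/
def mcAsympDisjoint {ι : Type*} (𝓑 : Set (Set ι)) (Y Z : Set (Set ι)) : Prop :=
  ∀ B ∈ 𝓑, mcBounded 𝓑 (mcE 𝓑 B Y ∩ mcE 𝓑 B Z)

/-- `U` is an asymptotic neighbourhood of `Y` in the `𝓑`-macrocube. -/
def mcAsympNbhd {ι : Type*} (𝓑 : Set (Set ι)) (Y U : Set (Set ι)) : Prop :=
  ∀ B ∈ 𝓑, mcBounded 𝓑 (mcE 𝓑 B Y \ U)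

/-- The `𝓑`-macrocube is normal: any two asymptotically disjoint subsets have
disjoint asymptotic neighbourhoods. -/
def mcNormal {ι : Type*} (𝓑 : Set (Set ι)) : Prop :=
  ∀ Y Z : Set (Set ι), Y ⊆ 𝓑 → Z ⊆ 𝓑 → mcAsympDisjoint 𝓑 Y Z →
    ∃ U V : Set (Set ι), mcAsympNbhd 𝓑 Y U ∧ mcAsympNbhd 𝓑 Z V ∧ Disjoint U V

/-- `𝓑` has a linearly ordered base. -/
def HasLinearBase {ι : Type*} (𝓑 : Set (Set ι)) : Prop :=
  ∃ 𝓒 ⊆ 𝓑, IsChain (· ⊆ ·) 𝓒 ∧ ∀ B ∈ 𝓑, ∃ C ∈ 𝓒, B ⊆ C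

open Set in
/-- A family of least cardinality among the families in `𝓑` with union outside `𝓑`, well-ordered
in its initial order type: unions over proper initial segments stay in `𝓑`. -/
theorem IsBornology.exists_wellOrdered_cover.{u} {ι : Type u} {𝓑 : Set (Set ι)}
    (hB : IsBornology 𝓑) (hunb : univ ∉ 𝓑) :
    ∃ (J : Type u) (_ : LinearOrder J) (_ : WellFoundedLT J) (b : J → Set ι),
      (∀ j, b j ∈ 𝓑) ∧ (⋃ j, b j) ∉ 𝓑 ∧
      ∀ (j : J) (s : J → Set ι), (∀ k, s k ∈ 𝓑) → (⋃ k ∈ Iio j, s k) ∈ 𝓑 := by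
  have hne : {𝒜 : Set (Set ι) | 𝒜 ⊆ 𝓑 ∧ ⋃₀ 𝒜 ∉ 𝓑}.Nonempty := by
    refine ⟨𝓑, subset_rfl, ?_⟩
    rwa [show ⋃₀ 𝓑 = univ from
      eq_univ_of_forall fun i => ⟨{i}, hB.1 _ (finite_singleton i), rfl⟩]
  obtain ⟨𝒜, ⟨h𝒜, hU⟩, hmin⟩ :=
    (InvImage.wf (fun 𝒜 : Set (Set ι) => Cardinal.mk 𝒜) Cardinal.lt_wf).has_min _ hne
  -- An abstract copy of `𝒜` keeps the inclusion order on subtypes from interfering.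
  obtain ⟨J, ⟨g⟩⟩ : ∃ J : Type u, Nonempty (J ≃ 𝒜) := ⟨𝒜, ⟨Equiv.refl _⟩⟩
  obtain ⟨_, _, hord⟩ := Cardinal.exists_ord_eq_type_lt J
  refine ⟨J, _, ‹_›, fun j => g j, fun j => h𝒜 (g j).2, ?_, fun j s hs => ?_⟩
  · rwa [g.surjective.iUnion_comp (fun A : 𝒜 => (A : Set ι)), ← sUnion_eq_iUnion]
  · by_contra hcon
    refine hmin (s '' Iio j) ⟨?_, by rwa [sUnion_image]⟩ ?_
    · rintro _ ⟨k, -, rfl⟩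
      exact hs k
    · exact Cardinal.mk_image_le.trans_lt
        ((Cardinal.mk_Iio_lt j hord).trans_eq (Cardinal.mk_congr g))

open Set in
/-- No family indexed as in `IsBornology.exists_wellOrdered_cover` is cofinal in `𝓑` when the
complements of the members of `𝓑` form an ultrafilter. -/
theorem IsBornology.exists_forall_not_subset {ι : Type*} {𝓑 : Set (Set ι)} (hB : IsBornology 𝓑)
    (hunb : univ ∉ 𝓑) (hultra : ∀ S : Set ι, S ∈ 𝓑 ∨ Sᶜ ∈ 𝓑)
    {J : Type*} [LinearOrder J] [WellFoundedLT J]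
    (hJ : ∀ (j : J) (s : J → Set ι), (∀ k, s k ∈ 𝓑) → (⋃ k ∈ Iio j, s k) ∈ 𝓑)
    (f : J → Set ι) (hf : ∀ j, f j ∈ 𝓑) :
    ∃ D ∈ 𝓑, ∀ j, ¬ D ⊆ f j := by
  have hout : ∀ A ∈ 𝓑, ∃ i, i ∉ A := fun A hA => by
    by_contra! h
    exact hunb (eq_univ_of_forall h ▸ hA)
  have hstep : ∀ (j : J) (e : J → ι × ι), ∃ q : ι × ι, q.1 ∉ f j ∧ q.2 ∉ f j ∧ q.1 ≠ q.2 ∧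
      ∀ k < j, q.1 ≠ (e k).2 ∧ q.2 ≠ (e k).1 := by
    intro j e
    have hA : f j ∪ ⋃ k ∈ Iio j, {(e k).1, (e k).2} ∈ 𝓑 :=
      hB.2.2 _ _ (hf j) (hJ j (fun k => {(e k).1, (e k).2}) fun k => hB.1 _ (toFinite _))
    obtain ⟨x, hx⟩ := hout _ hA
    obtain ⟨y, hy⟩ := hout _ (hB.2.2 _ _ hA (hB.1 {x} (finite_singleton x)))
    simp only [mem_union, mem_iUnion, mem_Iio, mem_insert_iff, mem_singleton_iff, not_or,
      not_exists] at hx hy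
    exact ⟨(x, y), hx.1, hy.1.1, fun h => hy.2 h.symm,
      fun k hk => ⟨(hx.2 k hk).2, (hy.1.2 k hk).1⟩⟩
  obtain ⟨i₀, -⟩ := hout ∅ (hB.1 _ finite_empty)
  choose q hq using hstep
  classical
  let e : J → ι × ι := wellFounded_lt.fix fun j ih =>
    q j fun k => if h : k < j then ih k h else (i₀, i₀)
  have he : ∀ j, (e j).1 ∉ f j ∧ (e j).2 ∉ f j ∧ (e j).1 ≠ (e j).2 ∧
      ∀ k < j, (e j).1 ≠ (e k).2 ∧ (e j).2 ≠ (e k).1 := by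
    intro j
    have h := hq j fun k => if k < j then e k else (i₀, i₀)
    have hej : e j = q j fun k => if k < j then e k else (i₀, i₀) :=
      WellFounded.fix_eq _ _ j
    rw [← hej] at h
    refine ⟨h.1, h.2.1, h.2.2.1, fun k hk => ?_⟩
    simpa [hk] using h.2.2.2 k hk
  rcases hultra (range fun j => (e j).1) with h | h
  · exact ⟨_, h, fun j hj => (he j).1 (hj ⟨j, rfl⟩)⟩
  · refine ⟨_, h, fun j hj => (he j).2.1 (hj ?_)⟩
    rintro ⟨k, hk : (e k).1 = (e j).2⟩
    rcases lt_trichotomy k j with hkj | rfl | hkj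
    · exact ((he j).2.2.2 k hkj).2 hk.symm
    · exact (he k).2.2.1 hk
    · exact ((he k).2.2.2 j hkj).1 hk

theorem mcBounded.exists_subset {ι : Type*} {𝓑 : Set (Set ι)} (hB : IsBornology 𝓑)
    {Y : Set (Set ι)} (hY : mcBounded 𝓑 Y) (hY𝓑 : Y ⊆ 𝓑) :
    ∃ B ∈ 𝓑, ∀ A ∈ Y, A ⊆ B := by
  obtain ⟨B, hB', h⟩ := hY
  rcases Y.eq_empty_or_nonempty with rfl | ⟨A₀, hA₀⟩
  · exact ⟨B, hB', by simp⟩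
  · refine ⟨B ∪ A₀, hB.2.2 _ _ hB' (hY𝓑 hA₀), fun A hA i hi => ?_⟩
    by_cases hi₀ : i ∈ A₀
    · exact Or.inr hi₀
    · exact Or.inl (h A hA A₀ hA₀ (Or.inl ⟨hi, hi₀⟩))

theorem mcBounded_of_forall_subset {ι : Type*} {𝓑 Y : Set (Set ι)} {B : Set ι} (hB : B ∈ 𝓑)
    (h : ∀ A ∈ Y, A ⊆ B) : mcBounded 𝓑 Y :=
  ⟨B, hB, fun A hA A' hA' => by
    rintro i (hi | hi)
    exacts [h A hA hi.1, h A' hA' hi.1]⟩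

theorem mcAsympNbhd.exists_forall_mem {ι : Type*} {𝓑 : Set (Set ι)} (hB : IsBornology 𝓑)
    {Y U : Set (Set ι)} (h : mcAsympNbhd 𝓑 Y U) {B : Set ι} (hB' : B ∈ 𝓑) :
    ∃ F ∈ 𝓑, ∀ A ∈ mcE 𝓑 B Y, ¬ A ⊆ F → A ∈ U := by
  obtain ⟨F, hF, h⟩ := (h B hB').exists_subset hB fun A hA => hA.1.1
  exact ⟨F, hF, fun A hA hAF => by_contra fun hAU => hAF (h A ⟨hA, hAU⟩)⟩

/-- The singletons are asymptotically disjoint from any chain with union outside `𝓑`. -/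
theorem mcAsympDisjoint_singletons_range {ι : Type*} {𝓑 : Set (Set ι)} (hB : IsBornology 𝓑)
    {J : Type*} [LinearOrder J] {C : J → Set ι} (hC : Monotone C) (hC𝓑 : ∀ j, C j ∈ 𝓑)
    (hU : (⋃ j, C j) ∉ 𝓑) :
    mcAsympDisjoint 𝓑 (Set.range fun i : ι => ({i} : Set ι)) (Set.range C) := by
  intro B hB'
  have hout : ∀ A ∈ 𝓑, ∃ x, (∃ j, x ∈ C j) ∧ x ∉ A := fun A hA => by
    by_contra! h
    exact hU (hB.2.1 A _ hA (Set.iUnion_subset fun j x hx => h x ⟨j, hx⟩))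
  obtain ⟨x, ⟨j, hxj⟩, hxB⟩ := hout B hB'
  obtain ⟨y, ⟨k, hyk⟩, hyB⟩ := hout _ (hB.2.2 _ _ hB' (hB.1 {x} (Set.finite_singleton x)))
  simp only [Set.mem_union, Set.mem_singleton_iff, not_or] at hyB
  refine mcBounded_of_forall_subset (hB.2.2 _ _ (hC𝓑 (max j k)) hB') ?_
  rintro A ⟨⟨-, _, ⟨i, rfl⟩, hi⟩, -, _, ⟨l, rfl⟩, hl⟩
  have huniq : ∀ z ∈ C l, z ∉ B → z = i := fun z hz hzB => by
    have hzA : z ∈ A := by_contra fun h => hzB (hl (Or.inr ⟨hz, h⟩))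
    exact by_contra fun h => hzB (hi (Or.inl ⟨hzA, h⟩))
  have hlt : l ≤ max j k := by
    by_contra! h
    have hx := huniq x (hC ((le_max_left j k).trans h.le) hxj) hxB
    have hy := huniq y (hC ((le_max_right j k).trans h.le) hyk) hyB.1
    exact hyB.2 (hy.trans hx.symm)
  intro z hz
  by_cases hzl : z ∈ C l
  · exact Or.inl (hC hlt hzl)
  · exact Or.inr (hl (Or.inl ⟨hz, hzl⟩))

/-- If `{I \ B : B ∈ 𝓑}` is an ultrafilter on `I`, then the `𝓑`-macrocube is
not normal. -/
theorem macrocube_not_normal_of_ultrafilter {I : Type*} [Infinite I]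
    (𝓑 : Set (Set I)) (hB : IsBornology 𝓑) (hunb : Set.univ ∉ 𝓑)
    (hultra : ∀ S : Set I, S ∈ 𝓑 ∨ Sᶜ ∈ 𝓑) :
    ¬ mcNormal 𝓑 := by
  intro hN
  obtain ⟨J, _, _, b, hb, hU, hinit⟩ := hB.exists_wellOrdered_cover hunb
  let C : J → Set I := fun j => (⋃ k ∈ Set.Iio j, b k) ∪ b j
  have hC𝓑 : ∀ j, C j ∈ 𝓑 := fun j =>
    hB.2.2 _ _ (hinit j b hb) (hb j)
  have hC : Monotone C := by
    intro j k hjk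
    refine Set.union_subset
      ((Set.biUnion_subset_biUnion_left (Set.Iio_subset_Iio hjk)).trans Set.subset_union_left) ?_
    rcases hjk.lt_or_eq with h | rfl
    · exact (Set.subset_biUnion_of_mem (s := Set.Iio k) (u := b) h).trans
        Set.subset_union_left
    · exact Set.subset_union_right
  have hCU : ∀ F ∈ 𝓑, ∃ j, ¬ C j ⊆ F := fun F hF => by
    by_contra! h
    exact hU (hB.2.1 F _ hF (Set.iUnion_subset fun j => Set.subset_union_right.trans (h j)))
  obtain ⟨U, V, hYU, hZV, hUV⟩ := hN _ _
    (Set.range_subset_iff.2 fun i => hB.1 _ (Set.finite_singleton i))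
    (Set.range_subset_iff.2 hC𝓑)
    (mcAsympDisjoint_singletons_range hB hC hC𝓑 fun h =>
      (hCU _ h).elim fun j hj => hj (Set.subset_iUnion C j))
  choose f hf𝓑 hf using fun j => hYU.exists_forall_mem hB (hC𝓑 j)
  obtain ⟨D, hD, hDf⟩ := hB.exists_forall_not_subset hunb hultra hinit f hf𝓑
  obtain ⟨F, hF, hFV⟩ := hZV.exists_forall_mem hB hD
  obtain ⟨j, hj⟩ := hCU F hF
  obtain ⟨i, hiD, hif⟩ := Set.not_subset.1 (hDf j)
  have hx : C j ∪ {i} ∈ 𝓑 := hB.2.2 _ _ (hC𝓑 j) (hB.1 _ (Set.finite_singleton i))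
  refine Set.disjoint_left.1 hUV (hf j (C j ∪ {i}) ⟨hx, {i}, ⟨i, rfl⟩, ?_⟩ ?_)
    (hFV (C j ∪ {i}) ⟨hx, C j, ⟨j, rfl⟩, ?_⟩ ?_)
  · rintro z (⟨hz | hz, h⟩ | ⟨hz, h⟩)
    exacts [hz, (h hz).elim, (h (Or.inr hz)).elim]
  · exact fun h => hif (h (Or.inr rfl))
  · rintro z (⟨hz | rfl, h⟩ | ⟨hz, h⟩)
    exacts [(h hz).elim, hiD, (h (Or.inl hz)).elim]
  · exact fun h => hj (Set.subset_union_left.trans h)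
end

section
/- Let 𝓑 be an unbounded bornology on an infinite set I. If 𝓑 has a linearly ordered base, then the 𝓑-macrocube is normal. -/
open scoped symmDiff

theorem mcE_mono {ι : Type*} {𝓑 : Set (Set ι)} {B C : Set ι} (h : B ⊆ C) (Y : Set (Set ι)) :
    mcE 𝓑 B Y ⊆ mcE 𝓑 C Y :=
  fun _ ⟨hA, A', hA', hs⟩ => ⟨hA, A', hA', hs.trans h⟩

theorem mcBounded.mono {ι : Type*} {𝓑 Y Z : Set (Set ι)} (hZ : mcBounded 𝓑 Z) (h : Y ⊆ Z) :
    mcBounded 𝓑 Y :=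
  let ⟨B, hB, hs⟩ := hZ
  ⟨B, hB, fun A hA A' hA' => hs A (h hA) A' (h hA')⟩

theorem mcAsympDisjoint.symm {ι : Type*} {𝓑 Y Z : Set (Set ι)} (h : mcAsympDisjoint 𝓑 Y Z) :
    mcAsympDisjoint 𝓑 Z Y :=
  fun B hB => Set.inter_comm (mcE 𝓑 B Y) _ ▸ h B hB

/-- The points that, at some scale in `𝓒`, are close to `Y` but not to `Z`. -/
def mcCloser {ι : Type*} (𝓑 𝓒 Y Z : Set (Set ι)) : Set (Set ι) :=
  ⋃ C ∈ 𝓒, mcE 𝓑 C Y \ mcE 𝓑 C Z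

theorem mcAsympNbhd_mcCloser {ι : Type*} {𝓑 𝓒 Y Z : Set (Set ι)} (h𝓒 : 𝓒 ⊆ 𝓑)
    (hcof : ∀ B ∈ 𝓑, ∃ C ∈ 𝓒, B ⊆ C) (h : mcAsympDisjoint 𝓑 Y Z) :
    mcAsympNbhd 𝓑 Y (mcCloser 𝓑 𝓒 Y Z) := by
  intro B hB
  obtain ⟨C, hC, hBC⟩ := hcof B hB
  refine (h C (h𝓒 hC)).mono fun A ⟨hA, hAU⟩ => ?_
  have hAC := mcE_mono hBC Y hA
  exact ⟨hAC, by_contra fun hAZ => hAU (Set.mem_biUnion hC ⟨hAC, hAZ⟩)⟩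

theorem disjoint_mcCloser {ι : Type*} {𝓑 𝓒 : Set (Set ι)} (h𝓒 : IsChain (· ⊆ ·) 𝓒)
    (Y Z : Set (Set ι)) : Disjoint (mcCloser 𝓑 𝓒 Y Z) (mcCloser 𝓑 𝓒 Z Y) := by
  refine Set.disjoint_left.2 fun A hU hV => ?_
  obtain ⟨C, hC, hCY, hCZ⟩ := Set.mem_iUnion₂.1 hU
  obtain ⟨D, hD, hDZ, hDY⟩ := Set.mem_iUnion₂.1 hV
  rcases h𝓒.total hC hD with h | h
  · exact hDY (mcE_mono h Y hCY)
  · exact hCZ (mcE_mono h Z hDZ)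

/-- If `𝓑` has a linearly ordered base, then the `𝓑`-macrocube is normal. -/
theorem macrocube_normal_of_hasLinearBase {I : Type*} [Infinite I]
    (𝓑 : Set (Set I)) (hB : IsBornology 𝓑) (hunb : Set.univ ∉ 𝓑)
    (hbase : HasLinearBase 𝓑) :
    mcNormal 𝓑 := by
  obtain ⟨𝓒, h𝓒, hchain, hcof⟩ := hbase
  intro Y Z _ _ h
  exact ⟨mcCloser 𝓑 𝓒 Y Z, mcCloser 𝓑 𝓒 Z Y, mcAsympNbhd_mcCloser h𝓒 hcof h,
    mcAsympNbhd_mcCloser h𝓒 hcof h.symm, disjoint_mcCloser hchain Y Z⟩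
end
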